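/- arXiv:1704.04072 — 2 statements merged into one kernel-verified Lean document; each statement's English description precedes it below -/
import Mathlib

section
/- The map σ restricts to a ℤ-linear map σ_I : I[Λ] → I[X] (i.e. σ maps the augmentation kernel of ℤ[Λ] into that of ℤ[X]), the relative norm ν_{Λ/R} maps I[R] into I[Λ], and the resulting sequence 0 → I[R] → I[Λ] → I[X] → 0, with maps induced by ν_{Λ/R} and σ, is a short exact sequence of ℤ-modules. -/
open Finsupp LinearMap Function

/-- The set of 2-element subsets of a finite set `X`. -/
abbrev Pairs (X : Type) : Type := {s : Finset X // s.card = 2}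

/-- The complement map `γ : Λ → Λ` sending a 2-element subset of a 4-element set to its
complement. -/
def gammaMap (X : Type) [Fintype X] [DecidableEq X] (hX : Fintype.card X = 4) :
    Pairs X → Pairs X :=
  fun l => ⟨(l : Finset X)ᶜ, by rw [Finset.card_compl, l.2, hX]⟩

/-- The augmentation `ε_E : ℤ[E] → ℤ`. -/
noncomputable def epsAug (E : Type) : (E →₀ ℤ) →ₗ[ℤ] ℤ :=
  Finsupp.lsum ℤ fun _ => LinearMap.id

/-- The norm `ν_E : ℤ → ℤ[E]`, `1 ↦ Σ_{e ∈ E} e`. -/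
noncomputable def nuNorm (E : Type) [Fintype E] : ℤ →ₗ[ℤ] (E →₀ ℤ) :=
  ∑ e : E, Finsupp.lsingle e

/-- The relative augmentation `ε_{Λ/R} : ℤ[Λ] → ℤ[R]`, `λ ↦ π(λ)`. -/
noncomputable def epsRel {Λ R : Type} (π : Λ → R) : (Λ →₀ ℤ) →ₗ[ℤ] (R →₀ ℤ) :=
  Finsupp.lmapDomain ℤ ℤ π

/-- The relative norm `ν_{Λ/R} : ℤ[R] → ℤ[Λ]`, `r ↦ Σ_{π(λ) = r} λ`. -/
noncomputable def nuRel {Λ R : Type} [Fintype Λ] [DecidableEq R] (π : Λ → R) :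
    (R →₀ ℤ) →ₗ[ℤ] (Λ →₀ ℤ) :=
  Finsupp.lsum ℤ fun r => ∑ l ∈ Finset.univ.filter fun l => π l = r, Finsupp.lsingle l

/-- The map `σ : ℤ[Λ] → ℤ[X]`, `λ ↦ Σ_{x ∈ λ} x`. -/
noncomputable def sigmaMap (X : Type) [Fintype X] [DecidableEq X] :
    (Pairs X →₀ ℤ) →ₗ[ℤ] (X →₀ ℤ) :=
  Finsupp.lsum ℤ fun l => ∑ x ∈ (l : Finset X), Finsupp.lsingle x

/-- The map `τ : ℤ[X] → ℤ[Λ]`, `x ↦ Σ_{λ ∋ x} λ`. -/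
noncomputable def tauMap (X : Type) [Fintype X] [DecidableEq X] :
    (X →₀ ℤ) →ₗ[ℤ] (Pairs X →₀ ℤ) :=
  Finsupp.lsum ℤ fun x =>
    ∑ l ∈ Finset.univ.filter fun l : Pairs X => x ∈ (l : Finset X), Finsupp.lsingle l

lemma epsAug_single (E : Type) (e : E) (n : ℤ) : epsAug E (single e n) = n := by
  simp [epsAug]

lemma sigmaMap_single (X : Type) [Fintype X] [DecidableEq X] (l : Pairs X) (n : ℤ) :
    sigmaMap X (single l n) = ∑ x ∈ (l : Finset X), single x n := by
  simp [sigmaMap]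

lemma nuRel_apply {Λ R : Type} [Fintype Λ] [DecidableEq R] (π : Λ → R) (β : R →₀ ℤ) (l : Λ) :
    nuRel π β l = β (π l) := by
  classical
  induction β using Finsupp.induction_linear with
  | zero => simp
  | add f g hf hg => simp [hf, hg]
  | single r n =>
    simp [nuRel, Finsupp.finsetSum_apply, Finsupp.single_apply, Finset.sum_ite_eq, eq_comm]

lemma eps_sigma (X : Type) [Fintype X] [DecidableEq X] (α : Pairs X →₀ ℤ) :
    epsAug X (sigmaMap X α) = 2 * epsAug (Pairs X) α := by
  induction α using Finsupp.induction_linear with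
  | zero => simp
  | add f g hf hg => simp [hf, hg, mul_add]
  | single l n => simp [sigmaMap_single, epsAug_single, l.2]

lemma gamma_ne (X : Type) [Fintype X] [DecidableEq X] (hX : Fintype.card X = 4) (l : Pairs X) :
    l ≠ gammaMap X hX l := by
  intro h
  have h1 : (l : Finset X) = (l : Finset X)ᶜ := congrArg Subtype.val h
  obtain ⟨x, hx⟩ : (l : Finset X).Nonempty := by
    rw [← Finset.card_pos, l.2]; norm_num
  have h2 := hx
  rw [h1, Finset.mem_compl] at h2
  exact h2 hx

lemma eps_nu (X R : Type) [Fintype X] [DecidableEq X] [DecidableEq R]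
    (hX : Fintype.card X = 4) (π : Pairs X → R) (hπsurj : Surjective π)
    (hπ : ∀ l m : Pairs X, π l = π m ↔ m = l ∨ m = gammaMap X hX l) (β : R →₀ ℤ) :
    epsAug (Pairs X) (nuRel π β) = 2 * epsAug R β := by
  induction β using Finsupp.induction_linear with
  | zero => simp
  | add f g hf hg => simp [hf, hg, mul_add]
  | single r n =>
    obtain ⟨l, rfl⟩ := hπsurj r
    have hf : (Finset.univ.filter fun m => π m = π l) = {l, gammaMap X hX l} := by
      ext m
      rw [Finset.mem_filter, eq_comm (a := π m), hπ]
      simp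
    have : nuRel π (single (π l) n) = single l n + single (gammaMap X hX l) n := by
      simp [nuRel, hf, Finset.sum_pair (gamma_ne X hX l)]
    rw [this, map_add, epsAug_single, epsAug_single, epsAug_single]
    ring

lemma inter_card (X : Type) [Fintype X] [DecidableEq X] (hX : Fintype.card X = 4)
    (l m : Pairs X) : (((l : Finset X) ∩ (m : Finset X)).card : ℤ) =
      1 + (if m = l then 1 else 0) - (if m = gammaMap X hX l then 1 else 0) := by
  have hle : ((l : Finset X) ∩ (m : Finset X)).card ≤ 2 :=
    (Finset.card_le_card Finset.inter_subset_left).trans_eq l.2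
  have h2 : ((l : Finset X) ∩ (m : Finset X)).card = 2 ↔ m = l := by
    constructor
    · intro h
      have e1 := Finset.eq_of_subset_of_card_le
        (Finset.inter_subset_left (s₁ := (l : Finset X)) (s₂ := (m : Finset X))) (by rw [h, l.2])
      have e2 := Finset.eq_of_subset_of_card_le
        (Finset.inter_subset_right (s₁ := (l : Finset X)) (s₂ := (m : Finset X))) (by rw [h, m.2])
      exact Subtype.ext (e2.symm.trans e1)
    · rintro rfl
      rw [Finset.inter_self, m.2]
  have h0 : ((l : Finset X) ∩ (m : Finset X)).card = 0 ↔ m = gammaMap X hX l := by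
    rw [Finset.card_eq_zero, ← Finset.disjoint_iff_inter_eq_empty]
    constructor
    · intro h
      apply Subtype.ext
      apply Finset.eq_of_subset_of_card_le
      · exact Finset.subset_compl_iff_disjoint_left.2 h
      · rw [(gammaMap X hX l).2, m.2]
    · rintro rfl
      exact disjoint_compl_right
  have hne := gamma_ne X hX l
  split_ifs with a b b
  · exact absurd (a.symm.trans b) hne
  · rw [h2.2 a]; norm_num
  · rw [h0.2 b]; norm_num
  · have : ((l : Finset X) ∩ (m : Finset X)).card = 1 := by
      have := mt h2.1 a
      have := mt h0.1 b
      omega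
    rw [this]; norm_num

lemma key (X : Type) [Fintype X] [DecidableEq X] (hX : Fintype.card X = 4)
    (l : Pairs X) (α : Pairs X →₀ ℤ) :
    ∑ x ∈ (l : Finset X), sigmaMap X α x =
      epsAug (Pairs X) α + α l - α (gammaMap X hX l) := by
  induction α using Finsupp.induction_linear with
  | zero => simp
  | add f g hf hg => simp only [map_add, Finsupp.add_apply, Finset.sum_add_distrib, hf, hg]; ring
  | single m n =>
    have h := inter_card X hX l m
    have h' : ∑ x ∈ (l : Finset X), sigmaMap X (single m n) x =
        (((l : Finset X) ∩ (m : Finset X)).card : ℤ) * n := by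
      simp [sigmaMap_single, Finsupp.finsetSum_apply, Finsupp.single_apply, Finset.sum_ite_eq]
    rw [h', h, epsAug_single, Finsupp.single_apply, Finsupp.single_apply]
    split_ifs <;> ring

lemma diff_lift (X : Type) [Fintype X] [DecidableEq X] (hX : Fintype.card X = 4) (x y : X) :
    ∃ α : Pairs X →₀ ℤ, epsAug _ α = 0 ∧ sigmaMap X α = single x 1 - single y 1 := by
  obtain ⟨z, hz⟩ : ∃ z, z ∉ ({x, y} : Finset X) := by
    by_contra! h
    have h1 : Fintype.card X ≤ ({x, y} : Finset X).card :=
      Finset.card_le_card (fun a _ => h a)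
    have := Finset.card_le_two (a := x) (b := y)
    omega
  simp only [Finset.mem_insert, Finset.mem_singleton, not_or] at hz
  refine ⟨single ⟨{x, z}, Finset.card_pair (Ne.symm hz.1)⟩ 1
    - single ⟨{y, z}, Finset.card_pair (Ne.symm hz.2)⟩ 1, ?_, ?_⟩
  · rw [map_sub, epsAug_single, epsAug_single, sub_self]
  · rw [map_sub, sigmaMap_single, sigmaMap_single, Finset.sum_pair (Ne.symm hz.1),
      Finset.sum_pair (Ne.symm hz.2)]
    abel

lemma sigma_lift (X : Type) [Fintype X] [DecidableEq X] (hX : Fintype.card X = 4) (y : X)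
    (z : X →₀ ℤ) :
    ∃ α : Pairs X →₀ ℤ, epsAug _ α = 0 ∧ sigmaMap X α = z - single y (epsAug X z) := by
  induction z using Finsupp.induction_linear with
  | zero => exact ⟨0, by simp⟩
  | add f g hf hg =>
    obtain ⟨a, ha, ha'⟩ := hf
    obtain ⟨b, hb, hb'⟩ := hg
    refine ⟨a + b, by simp [ha, hb], ?_⟩
    rw [map_add, ha', hb', map_add, single_add]
    abel
  | single x n =>
    obtain ⟨a, ha, ha'⟩ := diff_lift X hX x y
    refine ⟨n • a, by rw [map_smul, ha, smul_zero], ?_⟩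
    rw [map_smul, ha', epsAug_single, smul_sub, smul_single, smul_single]
    simp

/-- `σ` restricts to a map `σ_I : I[Λ] → I[X]`, `ν_{Λ/R}` maps `I[R]` into `I[Λ]`, and the
resulting sequence `0 → I[R] → I[Λ] → I[X] → 0` is a short exact sequence of `ℤ`-modules. -/
theorem statement3 (X R : Type) [Fintype X] [DecidableEq X] [DecidableEq R]
    (hX : Fintype.card X = 4) (π : Pairs X → R)
    (hπsurj : Surjective π)
    (hπ : ∀ l m : Pairs X, π l = π m ↔ m = l ∨ m = gammaMap X hX l) :
    ∃ (h1 : ∀ α ∈ LinearMap.ker (epsAug (Pairs X)), sigmaMap X α ∈ LinearMap.ker (epsAug X))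
      (h2 : ∀ β ∈ LinearMap.ker (epsAug R), nuRel π β ∈ LinearMap.ker (epsAug (Pairs X))),
      Injective ((nuRel π).restrict h2) ∧
        LinearMap.range ((nuRel π).restrict h2) = LinearMap.ker ((sigmaMap X).restrict h1) ∧
        Surjective ((sigmaMap X).restrict h1) := by
  refine ⟨fun α hα => ?_, fun β hβ => ?_, ?_, ?_, ?_⟩
  · rw [LinearMap.mem_ker] at hα ⊢
    rw [eps_sigma, hα, mul_zero]
  · rw [LinearMap.mem_ker] at hβ ⊢
    rw [eps_nu X R hX π hπsurj hπ, hβ, mul_zero]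
  · rintro ⟨a, ha⟩ ⟨b, hb⟩ h
    apply Subtype.ext
    have h' : nuRel π a = nuRel π b := congrArg Subtype.val h
    ext r
    obtain ⟨l, rfl⟩ := hπsurj r
    have := DFunLike.congr_fun h' l
    rwa [nuRel_apply, nuRel_apply] at this
  · ext ⟨α, hα⟩
    rw [LinearMap.mem_ker] at hα
    have hγ : ∀ l, π (gammaMap X hX l) = π l := fun l => ((hπ l _).2 (Or.inr rfl)).symm
    constructor
    · rintro ⟨⟨β, hβ⟩, h⟩
      have h' : nuRel π β = α := congrArg Subtype.val h
      rw [LinearMap.mem_ker]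
      apply Subtype.ext
      change sigmaMap X α = 0
      -- the sum of `σ α` over every pair vanishes, hence `σ α` vanishes
      have hs : ∀ l : Pairs X, ∑ x ∈ (l : Finset X), sigmaMap X α x = 0 := by
        intro l
        rw [key X hX, hα, ← h', nuRel_apply, nuRel_apply, hγ]
        ring
      have hp : ∀ x y, x ≠ y → sigmaMap X α x + sigmaMap X α y = 0 := by
        intro x y hxy
        have := hs ⟨{x, y}, Finset.card_pair hxy⟩
        rwa [Finset.sum_pair hxy] at this
      ext x
      obtain ⟨y, hy⟩ : ∃ y, y ∉ ({x} : Finset X) := by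
        by_contra! h
        have h1 : Fintype.card X ≤ ({x} : Finset X).card :=
          Finset.card_le_card (fun a _ => h a)
        rw [Finset.card_singleton] at h1
        omega
      obtain ⟨z, hz⟩ : ∃ z, z ∉ ({x, y} : Finset X) := by
        by_contra! h
        have h1 : Fintype.card X ≤ ({x, y} : Finset X).card :=
          Finset.card_le_card (fun a _ => h a)
        have := Finset.card_le_two (a := x) (b := y)
        omega
      simp only [Finset.mem_insert, Finset.mem_singleton, not_or] at hy hz
      have e1 := hp x y (Ne.symm hy)
      have e2 := hp x z (Ne.symm hz.1)
      have e3 := hp y z (Ne.symm hz.2)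
      rw [Finsupp.zero_apply]
      omega
    · intro h
      have h' : sigmaMap X α = 0 := congrArg Subtype.val (LinearMap.mem_ker.1 h)
      have hinv : ∀ l, α l = α (gammaMap X hX l) := by
        intro l
        have := key X hX l α
        rw [h', hα] at this
        simp only [Finsupp.zero_apply, Finset.sum_const_zero] at this
        omega
      have : Finite R := Finite.of_surjective π hπsurj
      let β : R →₀ ℤ := Finsupp.equivFunOnFinite.symm fun r => α (surjInv hπsurj r)
      have hβ : nuRel π β = α := by
        ext l
        rw [nuRel_apply]
        change α (surjInv hπsurj (π l)) = α l
        rcases (hπ l (surjInv hπsurj (π l))).1 (surjInv_eq hπsurj _).symm with e | e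
        · rw [e]
        · rw [e, ← hinv]
      have hβ0 : β ∈ LinearMap.ker (epsAug R) := by
        have := eps_nu X R hX π hπsurj hπ β
        rw [hβ, hα] at this
        rw [LinearMap.mem_ker]
        omega
      exact ⟨⟨β, hβ0⟩, Subtype.ext hβ⟩
  · rintro ⟨z, hz⟩
    obtain ⟨y⟩ : Nonempty X := Fintype.card_pos_iff.1 (by omega)
    obtain ⟨α, h0, h⟩ := sigma_lift X hX y z
    rw [LinearMap.mem_ker.1 hz, single_zero, sub_zero] at h
    exact ⟨⟨α, h0⟩, Subtype.ext h⟩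
end

section
/- Let J'[X] denote the cokernel of the ℤ-linear map ℤ → ℤ[X] ⊕ ℤ sending 1 to (ν_X(1), 2). The map ℤ[Λ] → ℤ[X] ⊕ ℤ, α ↦ (σ(α), ε_Λ(α)), sends the image of ν_{Λ/R} into the image of 1 ↦ (ν_X(1), 2), hence induces a map σ' : J[Λ/R] → J'[X]; the map ℤ[X] ⊕ ℤ → ℤ, (ξ, n) ↦ ε_X(ξ) − 2n, induces a map ε' : J'[X] → ℤ; and the sequence 0 → J[Λ/R] → J'[X] → ℤ → 0, with maps σ' and ε', is a short exact sequence of ℤ-modules. -/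
open Finsupp LinearMap Function

/-- The map `ℤ → ℤ[X] ⊕ ℤ`, `1 ↦ (ν_X(1), 2)`, whose cokernel is `J'[X]`. -/
noncomputable def dMap (X : Type) [Fintype X] : ℤ →ₗ[ℤ] (X →₀ ℤ) × ℤ :=
  (nuNorm X).prod ((2 : ℤ) • (LinearMap.id : ℤ →ₗ[ℤ] ℤ))

/-- The map `ℤ[Λ] → ℤ[X] ⊕ ℤ`, `α ↦ (σ(α), ε_Λ(α))`. -/
noncomputable def sigmaProd (X : Type) [Fintype X] [DecidableEq X] :
    (Pairs X →₀ ℤ) →ₗ[ℤ] (X →₀ ℤ) × ℤ :=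
  (sigmaMap X).prod (epsAug (Pairs X))

/-- The map `ℤ[X] ⊕ ℤ → ℤ`, `(ξ, n) ↦ ε_X(ξ) − 2n`. -/
noncomputable def epsMinus (X : Type) : (X →₀ ℤ) × ℤ →ₗ[ℤ] ℤ :=
  (epsAug X) ∘ₗ LinearMap.fst ℤ (X →₀ ℤ) ℤ - (2 : ℤ) • LinearMap.snd ℤ (X →₀ ℤ) ℤ

theorem sigmaMap_app (X : Type) [Fintype X] [DecidableEq X] (α : Pairs X →₀ ℤ) (x : X) :
    sigmaMap X α x = ∑ l : Pairs X, if x ∈ (l : Finset X) then α l else 0 := by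
  simp [sigmaMap, Finsupp.sum_fintype, Finsupp.finsetSum_apply, Finsupp.single_apply]

theorem epsAug_app (E : Type) [Fintype E] (α : E →₀ ℤ) : epsAug E α = ∑ l, α l := by
  simp [epsAug, Finsupp.sum_fintype]

theorem nuNorm_app (E : Type) [Fintype E] [DecidableEq E] (k : ℤ) (e : E) : nuNorm E k e = k := by
  simp [nuNorm, Finsupp.finsetSum_apply, Finsupp.single_apply]

theorem nuRel_app {Λ R : Type} [Fintype Λ] [DecidableEq Λ] [Fintype R] [DecidableEq R] (π : Λ → R)
    (β : R →₀ ℤ) (l : Λ) : nuRel π β l = β (π l) := by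
  have key : ∀ r : R, (∑ m ∈ Finset.univ.filter (fun m => π m = r),
      (Finsupp.single m (β r) : Λ →₀ ℤ) l) = if π l = r then β r else 0 := by
    intro r
    simp only [Finsupp.single_apply, Finset.sum_ite_eq', Finset.mem_filter, Finset.mem_univ,
      true_and]
  simp [nuRel, Finsupp.sum_fintype, Finsupp.finsetSum_apply, key]

/-- The pair `{x, y}`. -/
def mkPair {X : Type} [DecidableEq X] (x y : X) (h : x ≠ y) : Pairs X :=
  ⟨{x, y}, Finset.card_pair h⟩

theorem exists_four (X : Type) [Fintype X] [DecidableEq X] (hX : Fintype.card X = 4) :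
    ∃ a b c d : X, a ≠ b ∧ a ≠ c ∧ a ≠ d ∧ b ≠ c ∧ b ≠ d ∧ c ≠ d ∧
      (Finset.univ : Finset X) = {a, b, c, d} := by
  have := (Finset.card_eq_succ (s := (Finset.univ : Finset X)) (n := 3)).1 (by simpa using hX)
  obtain ⟨a, t, ha, ht, hc⟩ := this
  obtain ⟨b, c, d, h1, h2, h3, rfl⟩ := Finset.card_eq_three.1 hc
  simp only [Finset.mem_insert, Finset.mem_singleton, not_or] at ha
  exact ⟨a, b, c, d, ha.1, ha.2.1, ha.2.2, h1, h2, h3, ht.symm⟩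

theorem univ_pairs (X : Type) [Fintype X] [DecidableEq X] {a b c d : X}
    (ab : a ≠ b) (ac : a ≠ c) (ad : a ≠ d) (bc : b ≠ c) (bd : b ≠ d) (cd : c ≠ d)
    (hu : (Finset.univ : Finset X) = {a, b, c, d}) :
    (Finset.univ : Finset (Pairs X)) = {mkPair a b ab, mkPair a c ac, mkPair a d ad,
      mkPair b c bc, mkPair b d bd, mkPair c d cd} := by
  ext ⟨s, hs⟩
  obtain ⟨x, y, hxy, rfl⟩ := Finset.card_eq_two.1 hs
  have hx : x ∈ (Finset.univ : Finset X) := Finset.mem_univ x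
  have hy : y ∈ (Finset.univ : Finset X) := Finset.mem_univ y
  rw [hu] at hx hy
  simp only [Finset.mem_insert, Finset.mem_singleton] at hx hy
  simp only [Finset.mem_univ, Finset.mem_insert, Finset.mem_singleton, mkPair, Subtype.mk.injEq,
    true_iff]
  rcases hx with rfl | rfl | rfl | rfl <;> rcases hy with rfl | rfl | rfl | rfl <;>
    first
    | exact absurd rfl hxy
    | simp [Finset.pair_comm]

theorem pair_ne {X : Type} [DecidableEq X] {x y z w : X} (h : x ≠ y) (h' : z ≠ w)
    (hn : (x ≠ z ∧ x ≠ w) ∨ (y ≠ z ∧ y ≠ w)) : mkPair x y h ≠ mkPair z w h' := by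
  intro he
  have he : ({x, y} : Finset X) = {z, w} := congrArg Subtype.val he
  have h1 : x ∈ ({z, w} : Finset X) := he ▸ (by simp)
  have h2 : y ∈ ({z, w} : Finset X) := he ▸ (by simp)
  simp only [Finset.mem_insert, Finset.mem_singleton] at h1 h2
  tauto

theorem sum_pairs (X : Type) [Fintype X] [DecidableEq X] {a b c d : X}
    (ab : a ≠ b) (ac : a ≠ c) (ad : a ≠ d) (bc : b ≠ c) (bd : b ≠ d) (cd : c ≠ d)
    (hu : (Finset.univ : Finset X) = {a, b, c, d}) (f : Pairs X → ℤ) :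
    ∑ l, f l = f (mkPair a b ab) + (f (mkPair a c ac) + (f (mkPair a d ad) +
      (f (mkPair b c bc) + (f (mkPair b d bd) + f (mkPair c d cd))))) := by
  rw [univ_pairs X ab ac ad bc bd cd hu]
  have := ab.symm
  have := ac.symm
  have := ad.symm
  have := bc.symm
  have := bd.symm
  have := cd.symm
  repeat rw [Finset.sum_insert]
  · simp
  all_goals
    simp only [Finset.mem_insert, Finset.mem_singleton, not_or]
    repeat' apply And.intro
    all_goals exact pair_ne _ _ (by tauto)

theorem compl_pair {X : Type} [Fintype X] [DecidableEq X] (hX : Fintype.card X = 4) {a b c d : X}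
    (ab : a ≠ b) (ac : a ≠ c) (ad : a ≠ d) (bc : b ≠ c) (bd : b ≠ d) (cd : c ≠ d)
    (hu : ∀ x : X, x = a ∨ x = b ∨ x = c ∨ x = d) :
    gammaMap X hX (mkPair a b ab) = mkPair c d cd := by
  apply Subtype.ext
  ext x
  simp only [gammaMap, mkPair, Finset.mem_compl, Finset.mem_insert, Finset.mem_singleton]
  rcases hu x with rfl | rfl | rfl | rfl <;> simp [*, Ne.symm, ab.symm, ac.symm, ad.symm, bc.symm, bd.symm, cd.symm]

/-- Let `J'[X]` be the cokernel of `ℤ → ℤ[X] ⊕ ℤ`, `1 ↦ (ν_X(1), 2)`. The map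
`α ↦ (σ(α), ε_Λ(α))` sends the image of `ν_{Λ/R}` into the image of `1 ↦ (ν_X(1), 2)`, hence
induces `σ' : J[Λ/R] → J'[X]`; the map `(ξ, n) ↦ ε_X(ξ) − 2n` induces `ε' : J'[X] → ℤ`; and
`0 → J[Λ/R] → J'[X] → ℤ → 0` is a short exact sequence of `ℤ`-modules. -/
theorem statement5 (X R : Type) [Fintype X] [DecidableEq X] [DecidableEq R]
    (hX : Fintype.card X = 4) (π : Pairs X → R)
    (hπsurj : Surjective π)
    (hπ : ∀ l m : Pairs X, π l = π m ↔ m = l ∨ m = gammaMap X hX l) :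
    ∃ (h : LinearMap.range (nuRel π) ≤
        (LinearMap.range (dMap X)).comap (sigmaProd X))
      (h' : LinearMap.range (dMap X) ≤ LinearMap.ker (epsMinus X)),
      Injective (Submodule.mapQ (LinearMap.range (nuRel π))
          (LinearMap.range (dMap X)) (sigmaProd X) h) ∧
        LinearMap.range (Submodule.mapQ (LinearMap.range (nuRel π))
            (LinearMap.range (dMap X)) (sigmaProd X) h) =
          LinearMap.ker ((LinearMap.range (dMap X)).liftQ (epsMinus X) h') ∧
        Surjective ((LinearMap.range (dMap X)).liftQ (epsMinus X) h') := by
  classical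
  haveI : Fintype R := Fintype.ofSurjective π hπsurj
  obtain ⟨a, b, c, d, ab, ac, ad, bc, bd, cd, hu⟩ := exists_four X hX
  have hmem : ∀ x : X, x = a ∨ x = b ∨ x = c ∨ x = d := by
    intro x
    have := Finset.mem_univ x
    rw [hu] at this
    simpa using this
  have hsum := sum_pairs X ab ac ad bc bd cd hu
  have e1 : gammaMap X hX (mkPair a b ab) = mkPair c d cd :=
    compl_pair hX ab ac ad bc bd cd hmem
  have e2 : gammaMap X hX (mkPair a c ac) = mkPair b d bd :=
    compl_pair hX ac ab ad bc.symm cd bd (fun x => by have := hmem x; tauto)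
  have e3 : gammaMap X hX (mkPair a d ad) = mkPair b c bc :=
    compl_pair hX ad ab ac bd.symm cd.symm bc (fun x => by have := hmem x; tauto)
  have q1 : π (mkPair c d cd) = π (mkPair a b ab) := ((hπ _ _).2 (Or.inr e1.symm)).symm
  have q2 : π (mkPair b d bd) = π (mkPair a c ac) := ((hπ _ _).2 (Or.inr e2.symm)).symm
  have q3 : π (mkPair b c bc) = π (mkPair a d ad) := ((hπ _ _).2 (Or.inr e3.symm)).symm
  have hsig : ∀ α : Pairs X →₀ ℤ,
      sigmaMap X α a = α (mkPair a b ab) + α (mkPair a c ac) + α (mkPair a d ad) ∧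
      sigmaMap X α b = α (mkPair a b ab) + α (mkPair b c bc) + α (mkPair b d bd) ∧
      sigmaMap X α c = α (mkPair a c ac) + α (mkPair b c bc) + α (mkPair c d cd) ∧
      sigmaMap X α d = α (mkPair a d ad) + α (mkPair b d bd) + α (mkPair c d cd) := by
    intro α
    simp only [sigmaMap_app, hsum]
    simp [mkPair, ab, ac, ad, bc, bd, cd, ab.symm, ac.symm, ad.symm, bc.symm, bd.symm, cd.symm,
      add_assoc]
  have heps : ∀ α : Pairs X →₀ ℤ, epsAug (Pairs X) α = α (mkPair a b ab) + (α (mkPair a c ac) +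
      (α (mkPair a d ad) + (α (mkPair b c bc) + (α (mkPair b d bd) + α (mkPair c d cd))))) := by
    intro α
    rw [epsAug_app, hsum]
  have hepsX : ∀ ξ : X →₀ ℤ, epsAug X ξ = ξ a + (ξ b + (ξ c + ξ d)) := by
    intro ξ
    rw [epsAug_app, hu]
    simp [ab, ac, ad, bc, bd, cd]
  have hext : ∀ ξ η : X →₀ ℤ, ξ a = η a → ξ b = η b → ξ c = η c → ξ d = η d → ξ = η := by
    intro ξ η ha hb hc hd
    ext x
    rcases hmem x with rfl | rfl | rfl | rfl <;> assumption
  have h : LinearMap.range (nuRel π) ≤ (LinearMap.range (dMap X)).comap (sigmaProd X) := by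
    rintro _ ⟨β, rfl⟩
    refine ⟨β (π (mkPair a b ab)) + β (π (mkPair a c ac)) + β (π (mkPair a d ad)), ?_⟩
    obtain ⟨s1, s2, s3, s4⟩ := hsig (nuRel π β)
    have s5 := heps (nuRel π β)
    simp only [nuRel_app, q1, q2, q3] at s1 s2 s3 s4 s5
    refine Prod.ext ?_ ?_
    · change nuNorm X _ = sigmaMap X _
      apply hext <;> rw [nuNorm_app] <;> linarith
    · change (2 : ℤ) • (_ : ℤ) = epsAug _ _
      rw [s5]
      simp
      ring
  have h' : LinearMap.range (dMap X) ≤ LinearMap.ker (epsMinus X) := by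
    rintro _ ⟨k, rfl⟩
    change epsAug X (nuNorm X k) - (2 : ℤ) • ((2 : ℤ) • k) = 0
    rw [hepsX]
    simp only [nuNorm_app, smul_eq_mul]
    ring
  have hexact : ∀ p : (X →₀ ℤ) × ℤ, epsMinus X p = 0 → ∃ α, sigmaProd X α = p := by
    rintro ⟨ξ, n⟩ hp
    change epsAug X ξ - (2 : ℤ) • n = 0 at hp
    rw [hepsX, smul_eq_mul] at hp
    let α : Pairs X →₀ ℤ := Finsupp.single (mkPair a d ad) (ξ d) +
      Finsupp.single (mkPair b c bc) (n - ξ a) +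
      Finsupp.single (mkPair a b ab) (ξ b - n + ξ a) +
      Finsupp.single (mkPair a c ac) (ξ c - n + ξ a)
    have hs : ∀ (x y : X) (hxy : x ≠ y) (k : ℤ), sigmaMap X (Finsupp.single (mkPair x y hxy) k) =
        Finsupp.single x k + Finsupp.single y k := by
      intro x y hxy k
      simp [sigmaMap, mkPair, Finset.sum_pair hxy]
    have he : ∀ (l : Pairs X) (k : ℤ), epsAug (Pairs X) (Finsupp.single l k) = k := by
      intro l k
      simp [epsAug]
    refine ⟨α, Prod.ext ?_ ?_⟩
    · change sigmaMap X α = ξ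
      simp only [α, map_add, hs]
      apply hext <;> simp [Finsupp.single_apply, ab, ac, ad, bc, bd, cd, ab.symm, ac.symm,
        ad.symm, bc.symm, bd.symm, cd.symm] <;> linarith
    · change epsAug _ α = n
      simp only [α, map_add, he]
      linarith
  have hcomp : ∀ α, epsMinus X (sigmaProd X α) = 0 := by
    intro α
    change epsAug X (sigmaMap X α) - (2 : ℤ) • epsAug _ α = 0
    obtain ⟨s1, s2, s3, s4⟩ := hsig α
    rw [hepsX, heps, s1, s2, s3, s4, smul_eq_mul]
    ring
  refine ⟨h, h', ?_, ?_, ?_⟩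
  · rw [← LinearMap.ker_eq_bot, LinearMap.ker_eq_bot']
    intro m hm
    obtain ⟨α, rfl⟩ := Submodule.mkQ_surjective _ m
    simp only [Submodule.mkQ_apply, Submodule.mapQ_apply, Submodule.Quotient.mk_eq_zero] at hm ⊢
    obtain ⟨k, hk⟩ := hm
    have k1 : nuNorm X k = sigmaMap X α := congrArg Prod.fst hk
    have k2 : (2 : ℤ) • k = epsAug _ α := congrArg Prod.snd hk
    rw [heps, smul_eq_mul] at k2
    obtain ⟨s1, s2, s3, s4⟩ := hsig α
    simp only [← k1, nuNorm_app] at s1 s2 s3 s4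
    have hγ : ∀ l m : Pairs X, π l = π m → α l = α m := by
      have hg : ∀ l, α (gammaMap X hX l) = α l := by
        have gg : ∀ l, gammaMap X hX (gammaMap X hX l) = l := fun l =>
          Subtype.ext (compl_compl _)
        have f1 := gg (mkPair a b ab)
        have f2 := gg (mkPair a c ac)
        have f3 := gg (mkPair a d ad)
        rw [e1] at f1
        rw [e2] at f2
        rw [e3] at f3
        intro l
        have hl := Finset.mem_univ l
        rw [univ_pairs X ab ac ad bc bd cd hu] at hl
        simp only [Finset.mem_insert, Finset.mem_singleton] at hl
        rcases hl with rfl | rfl | rfl | rfl | rfl | rfl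
        · rw [e1]; linarith
        · rw [e2]; linarith
        · rw [e3]; linarith
        · rw [f3]; linarith
        · rw [f2]; linarith
        · rw [f1]; linarith
      intro l m hlm
      rcases (hπ l m).1 hlm with rfl | rfl
      · rfl
      · exact (hg l).symm
    refine ⟨Finsupp.equivFunOnFinite.symm fun r => α (surjInv hπsurj r), ?_⟩
    ext l
    rw [nuRel_app]
    exact hγ _ _ (surjInv_eq hπsurj _)
  · apply le_antisymm
    · rintro _ ⟨m, rfl⟩
      obtain ⟨α, rfl⟩ := Submodule.mkQ_surjective _ m
      exact hcomp α
    · intro m hm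
      obtain ⟨p, rfl⟩ := Submodule.mkQ_surjective _ m
      obtain ⟨α, rfl⟩ := hexact p hm
      exact ⟨Submodule.Quotient.mk α, rfl⟩
  · intro n
    refine ⟨Submodule.Quotient.mk (Finsupp.single a n, 0), ?_⟩
    change epsAug X (Finsupp.single a n) - (2 : ℤ) • (0 : ℤ) = n
    simp [epsAug]
end
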